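/- If g(x) ≤ g_*(x) for almost every x in the support of X, then for any K > (1−α)/(1−2α) there exists z₀ such that for all z > z₀: P[X > z] ≤ K · Φ_*(z). -/

import Mathlib

open MeasureTheory Filter Set

theorem integral_Ioi_eq_sub_intervalIntegral {f : ℝ → ℝ} (hf : Integrable f) (c x : ℝ) :
    ∫ y in Ioi x, f y = (∫ y in Ioi c, f y) - ∫ y in c..x, f y := by
  rw [← intervalIntegral.integral_interval_add_Ioi (a := c) (b := x) hf.integrableOn
    hf.integrableOn]
  ring

theorem continuous_integral_Ioi {f : ℝ → ℝ} (hf : Integrable f) :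
    Continuous fun x => ∫ y in Ioi x, f y := by
  have h : (fun x => ∫ y in Ioi x, f y) = fun x => (∫ y in Ioi 0, f y) - ∫ y in (0)..x, f y :=
    funext fun x => integral_Ioi_eq_sub_intervalIntegral hf 0 x
  rw [h]
  exact continuous_const.sub
    (intervalIntegral.continuous_primitive (fun a b => hf.intervalIntegrable) 0)

theorem hasDerivAt_integral_Ioi {f : ℝ → ℝ} (hf : Integrable f) (hfc : Continuous f) (x : ℝ) :
    HasDerivAt (fun x => ∫ y in Ioi x, f y) (-f x) x := by
  have h : (fun x => ∫ y in Ioi x, f y) = fun x => (∫ y in Ioi 0, f y) - ∫ y in (0)..x, f y :=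
    funext fun x => integral_Ioi_eq_sub_intervalIntegral hf 0 x
  rw [h]
  exact (hfc.integral_hasStrictDerivAt 0 x).hasDerivAt.const_sub _

theorem integrableOn_Ioi_inv_sq {ε : ℝ} (hε : 0 < ε) :
    IntegrableOn (fun y : ℝ => (y ^ 2)⁻¹) (Ioi ε) := by
  refine (integrableOn_Ioi_rpow_of_lt (a := -2) (by norm_num) hε).congr_fun ?_ measurableSet_Ioi
  intro y hy
  have : 0 < y := hε.trans hy
  simp only
  rw [Real.rpow_neg this.le]
  norm_cast

theorem setIntegral_Ioi_indicator_Iio_inv_sq {ε u : ℝ} (hε : 0 < ε) :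
    ∫ y in Ioi ε, (Iio u).indicator (fun y : ℝ => (y ^ 2)⁻¹) y
      = (Ioi ε).indicator (fun u => ε⁻¹ - u⁻¹) u := by
  rw [setIntegral_indicator measurableSet_Iio, Ioi_inter_Iio]
  by_cases hu : ε < u
  · rw [indicator_of_mem (mem_Ioi.2 hu), ← integral_Ioc_eq_integral_Ioo,
      ← intervalIntegral.integral_of_le hu.le]
    have hpos : ∀ y ∈ uIcc ε u, 0 < y := fun y hy => by
      rw [uIcc_of_le hu.le] at hy; exact hε.trans_le hy.1
    rw [intervalIntegral.integral_eq_sub_of_hasDerivAt (f := fun y => -y⁻¹)]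
    · ring
    · intro y hy
      simpa using (hasDerivAt_inv (hpos y hy).ne').fun_neg
    · refine ContinuousOn.intervalIntegrable fun y hy => ?_
      have := (hpos y hy).ne'
      exact ContinuousAt.continuousWithinAt (by fun_prop (disch := positivity))
  · rw [indicator_of_notMem (by simpa using hu), Ioo_eq_empty hu]
    simp

/-- Integration by parts for the truncated first moment `T y = ∫_y^∞ u f(u) du`. -/
theorem integral_tail_moment_div_sq {f : ℝ → ℝ} (hf : Integrable f)
    (hm : Integrable fun u => u * f u) {ε : ℝ} (hε : 0 < ε) :
    IntegrableOn (fun y => (∫ u in Ioi y, u * f u) * (y ^ 2)⁻¹) (Ioi ε) ∧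
    ∫ y in Ioi ε, (∫ u in Ioi y, u * f u) * (y ^ 2)⁻¹
      = (∫ u in Ioi ε, u * f u) / ε - ∫ u in Ioi ε, f u := by
  have hprod : Integrable (fun z : ℝ × ℝ => (z.1 ^ 2)⁻¹ * (z.2 * f z.2))
      ((volume.restrict (Ioi ε)).prod volume) := (integrableOn_Ioi_inv_sq hε).mul_prod hm
  have hS : MeasurableSet {z : ℝ × ℝ | z.1 < z.2} := measurableSet_lt measurable_fst measurable_snd
  have hint := hprod.indicator hS
  have hrow : ∀ y : ℝ, ∫ u, {z : ℝ × ℝ | z.1 < z.2}.indicator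
      (fun z : ℝ × ℝ => (z.1 ^ 2)⁻¹ * (z.2 * f z.2)) (y, u)
      = (∫ u in Ioi y, u * f u) * (y ^ 2)⁻¹ := by
    intro y
    rw [mul_comm, ← integral_const_mul, ← integral_indicator measurableSet_Ioi]
    rfl
  refine ⟨?_, ?_⟩
  · have := hint.integral_prod_left
    simp only [hrow] at this
    exact this
  · simp only [← hrow]
    rw [integral_integral_swap (f := fun y u => {z : ℝ × ℝ | z.1 < z.2}.indicator
      (fun z : ℝ × ℝ => (z.1 ^ 2)⁻¹ * (z.2 * f z.2)) (y, u)) hint]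
    have hcol : ∀ u : ℝ, ∫ y in Ioi ε, {z : ℝ × ℝ | z.1 < z.2}.indicator
        (fun z : ℝ × ℝ => (z.1 ^ 2)⁻¹ * (z.2 * f z.2)) (y, u)
        = (Ioi ε).indicator (fun u => (u * f u) / ε - f u) u := by
      intro u
      have h1 : ∀ y : ℝ, {z : ℝ × ℝ | z.1 < z.2}.indicator
          (fun z : ℝ × ℝ => (z.1 ^ 2)⁻¹ * (z.2 * f z.2)) (y, u)
          = (Iio u).indicator (fun y : ℝ => (y ^ 2)⁻¹) y * (u * f u) := by
        intro y
        by_cases h : y < u <;> simp [indicator, h]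
      simp only [h1]
      rw [integral_mul_const, setIntegral_Ioi_indicator_Iio_inv_sq hε]
      by_cases hu : ε < u
      · have : u ≠ 0 := (hε.trans hu).ne'
        simp only [indicator, mem_Ioi, hu, if_true]
        field_simp
      · simp [indicator, hu]
    simp only [hcol]
    rw [integral_indicator measurableSet_Ioi, integral_sub (hm.div_const ε).integrableOn
      hf.integrableOn, integral_div]

/-- If the truncated first moment of `h` vanishes at `0` and is nonpositive on `(0, ∞)`, then `h`
has nonnegative integral over `(0, ∞)`. -/
theorem integral_Ioi_nonneg_of_tail_moment_nonpos {h : ℝ → ℝ} (hh : Integrable h)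
    (hm : Integrable fun u => u * h u) (h0 : ∫ u in Ioi 0, u * h u = 0)
    (hneg : ∀ x : ℝ, 0 < x → ∫ u in Ioi x, u * h u ≤ 0) :
    0 ≤ ∫ u in Ioi 0, h u := by
  have key : ∀ ε : ℝ, 0 < ε → 0 ≤ (∫ u in Ioi ε, h u) + ∫ u in (0)..ε, |h u| := by
    intro ε hε
    have h1 := (integral_tail_moment_div_sq hh hm hε).2
    have h2 : ∫ y in Ioi ε, (∫ u in Ioi y, u * h u) * (y ^ 2)⁻¹ ≤ 0 :=
      setIntegral_nonpos measurableSet_Ioi fun y hy =>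
        mul_nonpos_of_nonpos_of_nonneg (hneg y (hε.trans hy)) (by positivity)
    have h3 : ∫ u in Ioi ε, u * h u = - ∫ u in (0)..ε, u * h u := by
      rw [integral_Ioi_eq_sub_intervalIntegral hm 0 ε, h0, zero_sub]
    have h4 : ∫ u in (0)..ε, u * h u ≤ ∫ u in (0)..ε, ε * |h u| := by
      refine intervalIntegral.integral_mono_on hε.le hm.intervalIntegrable
        (hh.abs.const_mul ε).intervalIntegrable fun u hu => ?_
      calc u * h u ≤ u * |h u| := mul_le_mul_of_nonneg_left (le_abs_self _) hu.1
        _ ≤ ε * |h u| := mul_le_mul_of_nonneg_right hu.2 (abs_nonneg _)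
    rw [intervalIntegral.integral_const_mul] at h4
    have h5 : -(∫ u in (0)..ε, |h u|) ≤ (∫ u in Ioi ε, u * h u) / ε := by
      rw [h3, le_div_iff₀ hε]
      linarith
    linarith
  have hc : Continuous fun ε => (∫ u in Ioi ε, h u) + ∫ u in (0)..ε, |h u| :=
    (continuous_integral_Ioi hh).add
      (intervalIntegral.continuous_primitive (fun a b => hh.abs.intervalIntegrable) 0)
  have hclosed : Ici (0 : ℝ) ⊆ {ε | 0 ≤ (∫ u in Ioi ε, h u) + ∫ u in (0)..ε, |h u|} := by
    rw [← closure_Ioi]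
    exact closure_minimal (fun ε hε => key ε hε) (isClosed_le continuous_const hc)
  simpa using hclosed (mem_Ici.2 le_rfl)

/-- Comparison of truncated first moments under an ordering of Stein factors. -/
theorem tail_moment_mul_le {p q g : ℝ → ℝ} (hpm : Integrable fun u => u * p u)
    (hqm : Integrable fun u => u * q u) (hq : Continuous q) (hg : Continuous g) {x : ℝ}
    (hx : 0 ≤ x) (hgpos : ∀ y ∈ Icc 0 x, 0 < g y) (hqpos : ∀ y ∈ Icc 0 x, 0 < q y)
    (hG : ∀ y ∈ Icc 0 x, ∫ u in Ioi y, u * q u = g y * q y)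
    (hF : ∀ᵐ y : ℝ, y ∈ Icc 0 x → ∫ u in Ioi y, u * p u ≤ g y * p y) :
    (∫ u in Ioi x, u * p u) * (∫ u in Ioi 0, u * q u)
      ≤ (∫ u in Ioi 0, u * p u) * (∫ u in Ioi x, u * q u) := by
  set F : ℝ → ℝ := fun y => ∫ u in Ioi y, u * p u with hFdef
  set G : ℝ → ℝ := fun y => ∫ u in Ioi y, u * q u with hGdef
  have hFc : Continuous F := continuous_integral_Ioi hpm
  have hGc : Continuous G := continuous_integral_Ioi hqm
  have hGpos : ∀ y ∈ Icc 0 x, 0 < G y := fun y hy => by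
    rw [hGdef]; simp only [hG y hy]; exact mul_pos (hgpos y hy) (hqpos y hy)
  set φ : ℝ → ℝ := fun y => y * F y / g y with hφ
  have hφm : Measurable φ := (measurable_id.mul hFc.measurable).div hg.measurable
  have hφc : ∀ y ∈ Icc 0 x, ContinuousAt φ y := fun y hy =>
    (continuous_id.mul hFc).continuousAt.div hg.continuousAt (hgpos y hy).ne'
  have hφi : ∀ y ∈ Icc 0 x, IntervalIntegrable φ volume y x := fun y hy => by
    refine ContinuousOn.intervalIntegrable fun t ht => ?_
    rw [uIcc_of_le hy.2] at ht
    exact (hφc t ⟨hy.1.trans ht.1, ht.2⟩).continuousWithinAt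
  set H : ℝ → ℝ := fun y => F x + ∫ t in y..x, φ t with hHdef
  have hHF : ∀ y ∈ Icc 0 x, H y ≤ F y := by
    intro y hy
    have h1 : F y = F x + ∫ t in y..x, t * p t := by
      have := integral_Ioi_eq_sub_intervalIntegral hpm y x
      simp only [hFdef]; linarith
    have h2 : ∫ t in y..x, φ t ≤ ∫ t in y..x, t * p t := by
      refine intervalIntegral.integral_mono_ae_restrict hy.2 (hφi y hy) hpm.intervalIntegrable ?_
      filter_upwards [ae_restrict_of_ae hF, ae_restrict_mem measurableSet_Icc] with t ht ht'
      have htm : t ∈ Icc 0 x := ⟨hy.1.trans ht'.1, ht'.2⟩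
      have := hgpos t htm
      simp only [hφ]
      rw [div_le_iff₀ this]
      have := mul_le_mul_of_nonneg_left (ht htm) htm.1
      simp only [hFdef]
      linarith
    rw [h1]; simp only [hHdef]; linarith
  have hHd : ∀ y ∈ Icc 0 x, HasDerivAt H (-φ y) y := fun y hy =>
    (intervalIntegral.integral_hasDerivAt_left (hφi y hy)
      hφm.stronglyMeasurable.stronglyMeasurableAtFilter (hφc y hy)).const_add _
  have hGd : ∀ y, HasDerivAt G (-(y * q y)) y := fun y =>
    hasDerivAt_integral_Ioi hqm (continuous_id.mul hq) y
  have hd : ∀ y ∈ Icc 0 x, HasDerivAt (fun y => H y / G y)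
      ((-φ y * G y - H y * (-(y * q y))) / G y ^ 2) y := fun y hy =>
    (hHd y hy).div (hGd y) (hGpos y hy).ne'
  have hanti : AntitoneOn (fun y => H y / G y) (Icc 0 x) := by
    refine antitoneOn_of_hasDerivWithinAt_nonpos (convex_Icc 0 x)
      (fun y hy => (hd y hy).continuousAt.continuousWithinAt)
      (fun y hy => (hd y (interior_subset hy)).hasDerivWithinAt) fun y hy => ?_
    have hy := interior_subset hy
    refine div_nonpos_of_nonpos_of_nonneg ?_ (sq_nonneg _)
    have h1 : φ y * G y = y * F y * q y := by
      have h2 := hG y hy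
      have h3 := (hgpos y hy).ne'
      simp only [hφ]
      change y * F y / g y * (∫ u in Ioi y, u * q u) = _
      rw [h2]; field_simp
    have h4 : y * H y * q y ≤ y * F y * q y :=
      mul_le_mul_of_nonneg_right (mul_le_mul_of_nonneg_left (hHF y hy) hy.1) (hqpos y hy).le
    linarith
  have h0 : (0 : ℝ) ∈ Icc 0 x := ⟨le_rfl, hx⟩
  have h1 : x ∈ Icc 0 x := ⟨hx, le_rfl⟩
  have h2 : H x / G x ≤ H 0 / G 0 := hanti h0 h1 hx
  have h3 : H x = F x := by simp [hHdef]
  rw [h3, div_le_div_iff₀ (hGpos x h1) (hGpos 0 h0)] at h2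
  exact h2.trans (mul_le_mul_of_nonneg_right (hHF 0 h0) (hGpos x h1).le)

/-- Half-line comparison of masses and first moments under an ordering of Stein factors on a
segment `s` issued from `0`. -/
theorem moment_mul_mass_le {p q g : ℝ → ℝ} (hp : Integrable p) (hqi : Integrable q)
    (hpm : Integrable fun u => u * p u)
    (hqm : Integrable fun u => u * q u) (hq : Continuous q) (hg : Continuous g) {s : Set ℝ}
    (hs : ∀ x ∈ s, Icc 0 x ⊆ s)
    (hgpos : ∀ y ∈ s, 0 ≤ y → 0 < g y) (hqpos : ∀ y ∈ s, 0 ≤ y → 0 < q y)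
    (hG : ∀ y ∈ s, 0 ≤ y → ∫ u in Ioi y, u * q u = g y * q y)
    (hF : ∀ᵐ y : ℝ, y ∈ s → ∫ u in Ioi y, u * p u ≤ g y * p y)
    (hGnonneg : ∀ y, 0 ≤ y → 0 ≤ ∫ u in Ioi y, u * q u)
    (hFnonpos : ∀ y, 0 ≤ y → y ∉ s → ∫ u in Ioi y, u * p u ≤ 0)
    (hF0 : 0 ≤ ∫ u in Ioi 0, u * p u) :
    (∀ x, 0 ≤ x → (∫ u in Ioi x, u * p u) * (∫ u in Ioi 0, u * q u)
      ≤ (∫ u in Ioi 0, u * p u) * (∫ u in Ioi x, u * q u)) ∧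
    (∫ u in Ioi 0, u * p u) * (∫ u in Ioi 0, q u)
      ≤ (∫ u in Ioi 0, u * q u) * (∫ u in Ioi 0, p u) := by
  have hcmp : ∀ x, 0 ≤ x → (∫ u in Ioi x, u * p u) * (∫ u in Ioi 0, u * q u)
      ≤ (∫ u in Ioi 0, u * p u) * (∫ u in Ioi x, u * q u) := by
    intro x hx
    by_cases hxs : x ∈ s
    · exact tail_moment_mul_le hpm hqm hq hg hx (fun y hy => hgpos y (hs x hxs hy) hy.1)
        (fun y hy => hqpos y (hs x hxs hy) hy.1) (fun y hy => hG y (hs x hxs hy) hy.1)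
        (hF.mono fun y h hy => h (hs x hxs hy))
    · exact (mul_nonpos_of_nonpos_of_nonneg (hFnonpos x hx hxs) (hGnonneg 0 le_rfl)).trans
        (mul_nonneg hF0 (hGnonneg x hx))
  refine ⟨hcmp, ?_⟩
  set A := ∫ u in Ioi 0, u * p u with hA
  set B := ∫ u in Ioi 0, u * q u with hB
  have hmul : (fun u => u * (B * p u - A * q u)) = fun u => B * (u * p u) - A * (u * q u) := by
    ext u; ring
  have htail : ∀ x : ℝ, ∫ u in Ioi x, u * (B * p u - A * q u)
      = B * (∫ u in Ioi x, u * p u) - A * (∫ u in Ioi x, u * q u) := fun x => by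
    rw [hmul, integral_sub (hpm.const_mul B).integrableOn (hqm.const_mul A).integrableOn,
      integral_const_mul, integral_const_mul]
  have := integral_Ioi_nonneg_of_tail_moment_nonpos (h := fun u => B * p u - A * q u)
    ((hp.const_mul B).sub (hqi.const_mul A))
    (by rw [hmul]; exact (hpm.const_mul B).sub (hqm.const_mul A))
    (by rw [htail]; ring)
    (fun x hx => by rw [htail]; linarith [hcmp x hx.le])
  rw [integral_sub (hp.const_mul B).integrableOn (hqi.const_mul A).integrableOn,
    integral_const_mul, integral_const_mul] at this
  linarith

theorem integral_Ioi_pos {f : ℝ → ℝ} (hf : Integrable f) {x : ℝ} (hpos : ∀ y, x < y → 0 < f y) :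
    0 < ∫ y in Ioi x, f y := by
  rw [setIntegral_pos_iff_support_of_nonneg_ae
    ((ae_restrict_mem measurableSet_Ioi).mono fun y hy => (hpos y hy).le) hf.integrableOn]
  have : Function.support f ∩ Ioi x = Ioi x :=
    inter_eq_right.2 fun y hy => (hpos y hy).ne'
  rw [this, Real.volume_Ioi]
  exact ENNReal.zero_lt_top

/-- For a centered density, the truncated first moment of the reflected density. -/
theorem tail_moment_comp_neg {f : ℝ → ℝ} (hm : Integrable fun y => y * f y)
    (h0 : ∫ y, y * f y = 0) (x : ℝ) :
    ∫ u in Ioi x, u * f (-u) = ∫ y in Ioi (-x), y * f y := by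
  have h1 : ∫ u in Ioi x, u * f (-u) = -∫ y in Iic (-x), y * f y := by
    rw [← integral_comp_neg_Ioi x (fun y => y * f y), ← integral_neg]
    simp
  have h2 := intervalIntegral.integral_Iic_add_Ioi (b := -x) hm.integrableOn hm.integrableOn
  rw [h1]
  linarith

/-- The truncated first moment of a centered Pearson density is nonnegative, and positive on the
support. -/
theorem pearson_tail_moment_nonneg {a : EReal} (ha : a < 0) {ρ g : ℝ → ℝ} (hg : Continuous g)
    (hρ : Continuous ρ) (hpos : ∀ x : ℝ, 0 < ρ x ↔ a < (x : EReal))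
    (hm : Integrable fun y => y * ρ y) (hcent : ∫ y, y * ρ y = 0)
    (hG : ∀ z : ℝ, a < (z : EReal) → ∫ y in Ioi z, y * ρ y = g z * ρ z) (x : ℝ) :
    (0 ≤ ∫ y in Ioi x, y * ρ y) ∧ (a < (x : EReal) → 0 < ∫ y in Ioi x, y * ρ y) := by
  rcases le_or_gt 0 x with hx | hx
  · have : 0 < ∫ y in Ioi x, y * ρ y := integral_Ioi_pos hm fun y hy =>
      mul_pos (hx.trans_lt hy)
        ((hpos y).2 (ha.trans (EReal.coe_pos.2 (hx.trans_lt hy))))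
    exact ⟨this.le, fun _ => this⟩
  induction a using EReal.rec with
  | top => exact absurd ha (by simp)
  | bot =>
    have : 0 < ∫ y in Ioi x, y * ρ y := by
      have h := tail_moment_comp_neg hm hcent (-x)
      rw [neg_neg] at h
      rw [← h]
      refine integral_Ioi_pos ?_ fun y hy => mul_pos (by linarith) ((hpos _).2 (EReal.bot_lt_coe _))
      simpa using hm.comp_neg.neg
    exact ⟨this.le, fun _ => this⟩
  | coe r =>
    have hr : r < 0 := EReal.coe_neg'.1 ha
    simp only [EReal.coe_lt_coe_iff] at hpos hG ⊢
    have hρr : ρ r = 0 := by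
      have h1 : ρ r ≤ 0 := not_lt.1 fun h => lt_irrefl r ((hpos r).1 h)
      have h2 : Ici r ⊆ {y | 0 ≤ ρ y} := by
        rw [← closure_Ioi]
        exact closure_minimal (fun y hy => ((hpos y).2 hy).le) (isClosed_le continuous_const hρ)
      exact le_antisymm h1 (h2 (mem_Ici.2 le_rfl))
    have hGr : ∫ y in Ioi r, y * ρ y = 0 := by
      have h2 : Ici r ⊆ {z | ∫ y in Ioi z, y * ρ y = g z * ρ z} := by
        rw [← closure_Ioi]
        exact closure_minimal (fun y hy => hG y hy)
          (isClosed_eq (continuous_integral_Ioi hm) (hg.mul hρ))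
      have h3 : ∫ y in Ioi r, y * ρ y = g r * ρ r := h2 (mem_Ici.2 le_rfl)
      rw [h3, hρr, mul_zero]
    rcases le_or_gt x r with hxr | hxr
    · refine ⟨?_, fun h => absurd h hxr.not_gt⟩
      rw [integral_Ioi_eq_sub_intervalIntegral hm r x, hGr, intervalIntegral.integral_symm]
      have : 0 ≤ ∫ y in x..r, y * ρ y := intervalIntegral.integral_nonneg hxr fun y hy =>
        mul_nonneg_of_nonpos_of_nonpos (by linarith [hy.2])
          (not_lt.1 fun h => hy.2.not_gt ((hpos y).1 h))
      linarith
    · have : 0 < ∫ y in Ioi x, y * ρ y := by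
        rw [integral_Ioi_eq_sub_intervalIntegral hm r x, hGr]
        have : 0 < ∫ y in r..x, -(y * ρ y) := intervalIntegral.intervalIntegral_pos_of_pos_on
          hm.neg.intervalIntegrable (fun y hy => by
            have := (hpos y).2 hy.1
            nlinarith [hy.2]) hxr
        rw [intervalIntegral.integral_neg] at this
        linarith
      exact ⟨this.le, fun _ => this⟩

/-- Corollary 4.6 of Eden–Viens, Pearson upper tail bound.
`Z` is a centered Pearson random variable whose density `ρZ` is positive exactly on
`(a,+∞)` (`-∞ ≤ a < 0`), with Stein factor `gZ(z) = α z² + β z + γ` there and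
`α < 1/2`; `Φ z = P[Z > z]`.  `X` is a centered square-integrable random variable
whose density `ρX` is positive exactly on an interval contained in `(a,+∞)`, with
Stein factor `gX`.  If `gX ≤ gZ` a.e. on the support of `X`, then for every
`K > (1-α)/(1-2α)` there is `z₀` such that for all `z > z₀`: `P[X > z] ≤ K Φ(z)`. -/
theorem stmt_12
    (a : EReal) (ha : a < 0) (α β γ : ℝ) (hα : α < 1 / 2)
    (ρZ : ℝ → ℝ)
    (hρZ_cont : Continuous ρZ)
    (hρZ_pos : ∀ x : ℝ, 0 < ρZ x ↔ a < (x : EReal))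
    (hρZ_diff : ∀ x : ℝ, a < (x : EReal) → DifferentiableAt ℝ ρZ x)
    (hρZ_int : Integrable ρZ)
    (hρZ_one : ∫ y, ρZ y = 1)
    (hZmom : Integrable fun y => y * ρZ y)
    (hZcent : ∫ y, y * ρZ y = 0)
    (hPearson : ∀ z : ℝ, a < (z : EReal) →
      (∫ y in Set.Ioi z, y * ρZ y) / ρZ z = α * z ^ 2 + β * z + γ)
    -- the random variable `X`, supported in an interval contained in `(a,+∞)`:
    (aX bX : EReal) (haX : a ≤ aX) (haXbX : aX < bX)
    (ρX : ℝ → ℝ)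
    (hρX_meas : Measurable ρX)
    (hρX_pos : ∀ x : ℝ, 0 < ρX x ↔ (aX < (x : EReal) ∧ (x : EReal) < bX))
    (hρX_int : Integrable ρX)
    (hρX_one : ∫ y, ρX y = 1)
    (hXmom : Integrable fun y => y * ρX y)
    (hXcent : ∫ y, y * ρX y = 0)
    (hXsq : Integrable fun y => y ^ 2 * ρX y)
    (gX : ℝ → ℝ)
    (hgX : ∀ x : ℝ, aX < (x : EReal) → (x : EReal) < bX →
      gX x = (∫ y in Set.Ioi x, y * ρX y) / ρX x)
    (hcmp : ∀ᵐ x : ℝ ∂volume, (aX < (x : EReal) ∧ (x : EReal) < bX) →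
      gX x ≤ α * x ^ 2 + β * x + γ) :
    ∀ K : ℝ, (1 - α) / (1 - 2 * α) < K →
      ∃ z₀ : ℝ, ∀ z : ℝ, z₀ < z →
        (∫ y in Set.Ioi z, ρX y) ≤ K * (∫ y in Set.Ioi z, ρZ y) := by
  intro K hK
  have hden : 0 < 1 - 2 * α := by linarith
  have hK1 : 1 + α < K := lt_of_le_of_lt
    (by rw [le_div_iff₀ hden]; nlinarith [sq_nonneg α]) hK
  have hKpos : 0 < K := lt_trans (div_pos (by linarith) hden) hK
  have haz : ∀ x : ℝ, 0 ≤ x → a < (x : EReal) := fun x hx =>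
    ha.trans_le (EReal.coe_nonneg.2 hx)
  have hΦpos : ∀ z : ℝ, 0 ≤ z → 0 ≤ ∫ y in Ioi z, ρZ y := fun z hz =>
    (integral_Ioi_pos hρZ_int fun y hy => (hρZ_pos y).2 (haz y (hz.trans hy.le))).le
  induction bX using EReal.rec with
  | bot => exact absurd haXbX not_lt_bot
  | coe b =>
    refine ⟨max b 0, fun z hz => ?_⟩
    have hb : b < z := (le_max_left _ _).trans_lt hz
    have h0 : 0 < z := (le_max_right _ _).trans_lt hz
    refine (setIntegral_nonpos measurableSet_Ioi fun y hy => ?_).trans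
      (mul_nonneg hKpos.le (hΦpos z h0.le))
    refine not_lt.1 fun h => ?_
    have := EReal.coe_lt_coe_iff.1 ((hρX_pos y).1 h).2
    exact absurd (hb.trans hy) this.not_gt
  | top =>
  simp only [EReal.coe_lt_top, and_true, forall_const] at hρX_pos hgX hcmp
  set g : ℝ → ℝ := fun z => α * z ^ 2 + β * z + γ with hg
  have hgc : Continuous g := by fun_prop
  have hGeq : ∀ z : ℝ, a < (z : EReal) → ∫ y in Ioi z, y * ρZ y = g z * ρZ z := fun z hz =>
    (div_eq_iff ((hρZ_pos z).2 hz).ne').1 (hPearson z hz)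
  have hGsign := pearson_tail_moment_nonneg ha hgc hρZ_cont hρZ_pos hZmom hZcent hGeq
  have hgpos : ∀ z : ℝ, a < (z : EReal) → 0 < g z := fun z hz => by
    have h1 := (hGsign z).2 hz
    rw [hGeq z hz] at h1
    exact pos_of_mul_pos_left h1 ((hρZ_pos z).2 hz).le
  have hFle : ∀ᵐ x : ℝ, aX < (x : EReal) → ∫ y in Ioi x, y * ρX y ≤ g x * ρX x := by
    filter_upwards [hcmp] with x hx hax
    have h1 := hx hax
    rwa [hgX x hax, div_le_iff₀ ((hρX_pos x).2 hax)] at h1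
  have haX0 : aX < 0 := by
    by_contra! hcon
    induction aX using EReal.rec with
    | top => exact absurd haXbX (lt_irrefl _)
    | bot => simp at hcon
    | coe c =>
      simp only [EReal.coe_lt_coe_iff] at hρX_pos
      have hc : 0 ≤ c := EReal.coe_nonneg.1 hcon
      have hi : Integrable fun y => y * ρX y - c * ρX y := hXmom.sub (hρX_int.const_mul c)
      have h1 : ∫ y, (y * ρX y - c * ρX y) = -c := by
        rw [integral_sub hXmom (hρX_int.const_mul c), integral_const_mul, hXcent, hρX_one]
        ring
      have h2 : ∀ y, 0 ≤ y * ρX y - c * ρX y := fun y => by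
        rw [← sub_mul]
        rcases le_or_gt y c with h | h
        · exact mul_nonneg_of_nonpos_of_nonpos (by linarith)
            (not_lt.1 fun h' => h.not_gt ((hρX_pos y).1 h'))
        · exact mul_nonneg (by linarith) ((hρX_pos y).2 h).le
      have h3 : 0 < ∫ y in Ioi c, (y * ρX y - c * ρX y) := integral_Ioi_pos hi fun y hy => by
        rw [← sub_mul]
        exact mul_pos (by linarith) ((hρX_pos y).2 hy)
      have h4 := setIntegral_le_integral (s := Ioi c) hi (Eventually.of_forall h2)
      linarith
  have hXpos : ∀ x : ℝ, 0 ≤ x → 0 < ρX x := fun x hx =>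
    (hρX_pos x).2 (haX0.trans_le (EReal.coe_nonneg.2 hx))
  have hF0 : 0 ≤ ∫ y in Ioi 0, y * ρX y := setIntegral_nonneg measurableSet_Ioi fun y hy =>
    mul_nonneg (le_of_lt hy) (hXpos y (le_of_lt hy)).le
  obtain ⟨hmono, hright⟩ := moment_mul_mass_le hρX_int hρZ_int hXmom hZmom hρZ_cont hgc
    (s := Ici 0) (fun x hx y hy => hy.1) (fun y _ hy => hgpos y (haz y hy))
    (fun y _ hy => (hρZ_pos y).2 (haz y hy)) (fun y _ hy => hGeq y (haz y hy))
    (hFle.mono fun y h hy => h (haX0.trans_le (EReal.coe_nonneg.2 hy)))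
    (fun y _ => (hGsign y).1) (fun y hy hys => absurd hy hys) hF0
  have hreflX := tail_moment_comp_neg hXmom hXcent
  have hreflZ := tail_moment_comp_neg hZmom hZcent
  obtain ⟨-, hleft⟩ := moment_mul_mass_le (p := fun u => ρX (-u)) (q := fun u => ρZ (-u))
    (g := fun u => g (-u)) (s := {u : ℝ | aX < ((-u : ℝ) : EReal)}) hρX_int.comp_neg
    hρZ_int.comp_neg (by simpa using hXmom.comp_neg.neg) (by simpa using hZmom.comp_neg.neg)
    (by fun_prop) (by fun_prop)
    (fun x hx y hy => lt_of_lt_of_le hx (EReal.coe_le_coe_iff.2 (neg_le_neg hy.2)))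
    (fun y hy _ => hgpos _ (haX.trans_lt hy)) (fun y hy _ => (hρZ_pos _).2 (haX.trans_lt hy))
    (fun y hy _ => by rw [hreflZ]; exact hGeq _ (haX.trans_lt hy))
    (by
      have h := (Measure.measurePreserving_neg (volume : Measure ℝ)).quasiMeasurePreserving.ae hFle
      filter_upwards [h] with y hy hys
      rw [hreflX]
      exact hy hys)
    (fun y _ => by rw [hreflZ]; exact (hGsign _).1)
    (fun y hy hys => setIntegral_nonpos measurableSet_Ioi fun u hu => by
      have hyu : y < u := hu
      refine mul_nonpos_of_nonneg_of_nonpos (by linarith) (not_lt.1 fun h => hys ?_)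
      exact ((hρX_pos _).1 h).trans_le (EReal.coe_le_coe_iff.2 (by linarith)))
    (by rw [hreflX, neg_zero]; exact hF0)
  simp only [hreflX, hreflZ, neg_zero, integral_comp_neg_Ioi] at hleft
  have hsplitX := intervalIntegral.integral_Iic_add_Ioi (b := 0) hρX_int.integrableOn
    hρX_int.integrableOn
  have hsplitZ := intervalIntegral.integral_Iic_add_Ioi (b := 0) hρZ_int.integrableOn
    hρZ_int.integrableOn
  rw [hρX_one] at hsplitX
  rw [hρZ_one] at hsplitZ
  set A := ∫ y in Ioi 0, y * ρX y
  set B := ∫ y in Ioi 0, y * ρZ y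
  have hB : 0 < B := (hGsign 0).2 (haz 0 le_rfl)
  have hAB : A ≤ B := by
    have h1 : A * ((∫ y in Iic 0, ρZ y) + ∫ y in Ioi 0, ρZ y)
        ≤ B * ((∫ y in Iic 0, ρX y) + ∫ y in Ioi 0, ρX y) := by linarith
    rwa [hsplitX, hsplitZ, mul_one, mul_one] at h1
  have hFG : ∀ x : ℝ, 0 ≤ x → ∫ y in Ioi x, y * ρX y ≤ ∫ y in Ioi x, y * ρZ y := fun x hx =>
    le_of_mul_le_mul_right
      (((hmono x hx).trans (mul_le_mul_of_nonneg_right hAB (hGsign x).1)).trans_eq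
        (mul_comm _ _)) hB
  have hδ : 0 < K - 1 - α := by linarith
  refine ⟨max 1 ((|β| + |γ|) / (K - 1 - α)), fun z hz => ?_⟩
  have hz1 : 1 < z := (le_max_left _ _).trans_lt hz
  have hz2 : (|β| + |γ|) / (K - 1 - α) < z := (le_max_right _ _).trans_lt hz
  have hz0 : 0 < z := by linarith
  have hpoly : ∀ y, z < y → g y * (y ^ 2)⁻¹ ≤ K - 1 := by
    intro y hy
    have hy1 : 1 < y := hz1.trans hy
    have h1 : |β| + |γ| < y * (K - 1 - α) := (div_lt_iff₀ hδ).1 (hz2.trans hy)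
    have h2 : β * y ≤ |β| * y := mul_le_mul_of_nonneg_right (le_abs_self β) (by linarith)
    have h3 : γ ≤ |γ| * y := (le_abs_self γ).trans (le_mul_of_one_le_right (abs_nonneg γ) hy1.le)
    have h4 : (|β| + |γ|) * y ≤ y * (K - 1 - α) * y :=
      mul_le_mul_of_nonneg_right h1.le (by linarith)
    rw [← div_eq_mul_inv, div_le_iff₀ (by positivity)]
    simp only [hg]
    nlinarith
  obtain ⟨hTi, hT⟩ := integral_tail_moment_div_sq hρZ_int hZmom hz0
  have hTle : ∫ y in Ioi z, (∫ u in Ioi y, u * ρZ u) * (y ^ 2)⁻¹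
      ≤ ∫ y in Ioi z, (K - 1) * ρZ y := by
    refine setIntegral_mono_on hTi (hρZ_int.const_mul _).integrableOn measurableSet_Ioi
      fun y hy => ?_
    have hay := haz y (hz0.trans hy).le
    rw [hGeq y hay, mul_right_comm]
    exact mul_le_mul_of_nonneg_right (hpoly y hy) ((hρZ_pos y).2 hay).le
  rw [integral_const_mul, hT] at hTle
  have hXle : ∫ y in Ioi z, ρX y ≤ (∫ y in Ioi z, y * ρX y) / z := by
    rw [← integral_div]
    refine setIntegral_mono_on hρX_int.integrableOn (hXmom.div_const z).integrableOn
      measurableSet_Ioi fun y hy => ?_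
    have hzy : z < y := hy
    rw [le_div_iff₀ hz0, mul_comm]
    exact mul_le_mul_of_nonneg_right hzy.le (hXpos y (hz0.trans hy).le).le
  have := div_le_div_of_nonneg_right (hFG z hz0.le) hz0.le
  linarith
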